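/- arXiv:2502.00405 — 2 statements merged into one kernel-verified Lean document; each statement's English description precedes it below -/
import Mathlib

section
/- For every integer ν ≥ 5, the distance spectral radius of K_1 ∨ (K_{ν−4} ∪ 3K_1) is the largest real root of x³ − (ν−1)x² − (9ν−29)x − 5ν + 17 = 0. -/
/-- The graph `K_1 ∨ (K_{ν−4} ∪ 3K_1)` on `Fin ν`: vertex `0` is the join
vertex, vertices `1, …, ν−4` form the clique `K_{ν−4}`, and the last three
vertices are the isolated part. -/
def joinGraph (ν : ℕ) : SimpleGraph (Fin ν) :=
  SimpleGraph.fromRel (fun u v => u.val = 0 ∨ (u.val < ν - 3 ∧ v.val < ν - 3))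

/-- The distance matrix of a graph `G` over `ℝ`. -/
noncomputable def distMatrix {V : Type*} (G : SimpleGraph V) : Matrix V V ℝ :=
  Matrix.of fun u v => (G.dist u v : ℝ)

/-- A nonnegative real matrix with a positive eigenvector for `r` has no real eigenvalue
larger than `r`. -/
theorem Matrix.le_of_mem_spectrum_of_pos_eigenvector {ι : Type*} [Fintype ι] [DecidableEq ι]
    {A : Matrix ι ι ℝ} (hA : ∀ i j, 0 ≤ A i j) {w : ι → ℝ} (hw : ∀ i, 0 < w i) {r : ℝ}
    (h : A.mulVec w = r • w) {μ : ℝ} (hμ : μ ∈ spectrum ℝ A) : μ ≤ r := by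
  rw [← Matrix.spectrum_toLin', ← Module.End.hasEigenvalue_iff_mem_spectrum] at hμ
  obtain ⟨x, hx⟩ := hμ.exists_hasEigenvector
  have hAx : A.mulVec x = μ • x := by simpa using hx.apply_eq_smul
  obtain ⟨k, hk⟩ := Function.ne_iff.mp hx.2
  obtain ⟨i, -, hi⟩ := Finset.exists_max_image Finset.univ (fun j => |x j| / w j)
    ⟨k, Finset.mem_univ k⟩
  set t := |x i| / w i
  have hxt : ∀ j, |x j| ≤ t * w j := fun j =>
    (div_le_iff₀ (hw j)).mp (hi j (Finset.mem_univ j))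
  have htpos : 0 < t :=
    (div_pos (abs_pos.mpr hk) (hw k)).trans_le (hi k (Finset.mem_univ k))
  have hxi : |x i| = t * w i := (div_mul_cancel₀ _ (hw i).ne').symm
  have hrow : ∑ j, A i j * w j = r * w i := congrFun h i
  have hrowx : ∑ j, A i j * x j = μ * x i := congrFun hAx i
  have key : |μ| * (t * w i) ≤ r * (t * w i) := calc
    |μ| * (t * w i) = |∑ j, A i j * x j| := by rw [hrowx, abs_mul, hxi]
    _ ≤ ∑ j, |A i j * x j| := Finset.abs_sum_le_sum_abs _ _
    _ ≤ ∑ j, t * (A i j * w j) := Finset.sum_le_sum fun j _ => by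
        rw [abs_mul, abs_of_nonneg (hA i j), mul_left_comm]
        exact mul_le_mul_of_nonneg_left (hxt j) (hA i j)
    _ = r * (t * w i) := by rw [← Finset.mul_sum, hrow]; ring
  exact (le_abs_self μ).trans (le_of_mul_le_mul_right key (mul_pos htpos (hw i)))

/-- An eigenvalue of a matrix, witnessed by a nonzero eigenvector, lies in its spectrum. -/
theorem Matrix.mem_spectrum_of_mulVec_eq_smul {ι : Type*} [Fintype ι] [DecidableEq ι]
    {A : Matrix ι ι ℝ} {w : ι → ℝ} (hw : w ≠ 0) {r : ℝ} (h : A.mulVec w = r • w) :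
    r ∈ spectrum ℝ A := by
  rw [← Matrix.spectrum_toLin', ← Module.End.hasEigenvalue_iff_mem_spectrum]
  exact Module.End.hasEigenvalue_of_hasEigenvector
    (Module.End.hasEigenvector_iff.mpr ⟨Module.End.mem_eigenspace_iff.mpr (by simpa using h), hw⟩)

theorem joinGraph_adj {ν : ℕ} {u v : Fin ν} : (joinGraph ν).Adj u v ↔
    u ≠ v ∧ (u.val = 0 ∨ v.val = 0 ∨ (u.val < ν - 3 ∧ v.val < ν - 3)) := by
  simp only [joinGraph, SimpleGraph.fromRel_adj]
  tauto

theorem joinGraph_dist {ν : ℕ} (u v : Fin ν) : (joinGraph ν).dist u v =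
    if u.val = v.val then 0
    else if u.val = 0 ∨ v.val = 0 ∨ (u.val < ν - 3 ∧ v.val < ν - 3) then 1 else 2 := by
  split_ifs with h h'
  · rw [Fin.ext h, SimpleGraph.dist_self]
  · exact SimpleGraph.dist_eq_one_iff_adj.mpr (joinGraph_adj.mpr ⟨fun e => h (by rw [e]), h'⟩)
  · have hne : u ≠ v := fun e => h (by rw [e])
    push Not at h'
    let z : Fin ν := ⟨0, u.pos⟩
    have huz : (joinGraph ν).Adj u z :=
      joinGraph_adj.mpr ⟨fun e => h'.1 (by rw [e]), Or.inr (Or.inl rfl)⟩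
    have hzv : (joinGraph ν).Adj z v :=
      joinGraph_adj.mpr ⟨fun e => h'.2.1 (by rw [← e]), Or.inl rfl⟩
    have hle := SimpleGraph.dist_le (.cons huz (.cons hzv .nil))
    simp only [SimpleGraph.Walk.length_cons, SimpleGraph.Walk.length_nil] at hle
    have h0 := (huz.reachable.trans hzv.reachable).pos_dist_of_ne hne
    have h1 : (joinGraph ν).dist u v ≠ 1 := fun e => by
      have := (joinGraph_adj.mp (SimpleGraph.dist_eq_one_iff_adj.mp e)).2
      omega
    omega

/-- The vector on the vertices of `joinGraph (m + 4)` that is `a` on the join vertex, `c` on the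
clique and `b` on the isolated part. -/
def classVec (m : ℕ) (a b c : ℝ) (j : ℕ) : ℝ :=
  if j = 0 then a else if j < m + 1 then c else b

theorem sum_classVec (m : ℕ) (a b c : ℝ) :
    ∑ j : Fin (m + 4), classVec m a b c j = a + 3 * b + m * c := by
  rw [Fin.sum_univ_eq_sum_range (classVec m a b c), Finset.sum_range_succ, Finset.sum_range_succ,
    Finset.sum_range_succ, Finset.sum_range_succ']
  have : ∑ j ∈ Finset.range m, classVec m a b c (j + 1) = ∑ j ∈ Finset.range m, c :=
    Finset.sum_congr rfl fun j hj => by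
      have := Finset.mem_range.mp hj
      simp [classVec, this]
  rw [this]
  simp [classVec]
  ring

theorem distMatrix_joinGraph_mulVec {m : ℕ} {a b c r : ℝ}
    (h0 : 3 * b + m * c = r * a) (hb : a + 4 * b + 2 * m * c = r * b)
    (hc : a + 6 * b + (m - 1) * c = r * c) :
    (distMatrix (joinGraph (m + 4))).mulVec (fun j => classVec m a b c j) =
      r • fun j : Fin (m + 4) => classVec m a b c j := by
  funext i
  have row : ∀ a' b' c' d : ℝ,
      (∀ j : Fin (m + 4), distMatrix (joinGraph (m + 4)) i j * classVec m a b c j =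
        classVec m a' b' c' j - if j = i then d else 0) →
      ∑ j, distMatrix (joinGraph (m + 4)) i j * classVec m a b c j =
        a' + 3 * b' + m * c' - d := fun a' b' c' d h => by
    rw [Finset.sum_congr rfl fun j _ => h j, Finset.sum_sub_distrib, sum_classVec]
    simp
  change ∑ j, distMatrix (joinGraph (m + 4)) i j * classVec m a b c j = r * classVec m a b c i
  by_cases hi0 : i.val = 0
  · rw [row a b c a]
    · simp only [classVec, hi0, if_true]; linarith
    · intro j
      simp only [distMatrix, Matrix.of_apply, joinGraph_dist, classVec, Fin.ext_iff]
      split_ifs <;> first | omega | (push_cast; ring)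
  · by_cases hi : i.val < m + 1
    · rw [row a (2 * b) c c]
      · simp only [classVec, hi0, hi, if_true, if_false]; linarith
      · intro j
        simp only [distMatrix, Matrix.of_apply, joinGraph_dist, classVec, Fin.ext_iff]
        split_ifs <;> first | omega | (push_cast; ring)
    · rw [row a (2 * b) (2 * c) (2 * b)]
      · simp only [classVec, hi0, hi, if_false]; linarith
      · intro j
        simp only [distMatrix, Matrix.of_apply, joinGraph_dist, classVec, Fin.ext_iff]
        split_ifs <;> first | omega | (push_cast; ring)

theorem exists_pos_eigenvector_of_cubic {m : ℕ} {r : ℝ} (hr : 0 < r)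
    (h : r ^ 3 - (m + 3) * r ^ 2 - (9 * m + 7) * r - 5 * m - 3 = 0) :
    ∃ w : Fin (m + 4) → ℝ, (∀ i, 0 < w i) ∧
      (distMatrix (joinGraph (m + 4))).mulVec w = r • w := by
  have hm : (0 : ℝ) ≤ m := m.cast_nonneg
  have ha : r * ((3 * (r + m + 1) + m * (r + 2)) / r) = 3 * (r + m + 1) + m * (r + 2) :=
    mul_div_cancel₀ _ hr.ne'
  have hapos : 0 < (3 * (r + m + 1) + m * (r + 2)) / r := by positivity
  generalize (3 * (r + m + 1) + m * (r + 2)) / r = a at ha hapos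
  refine ⟨fun j => classVec m a (r + m + 1) (r + 2) j, fun i => ?_,
    distMatrix_joinGraph_mulVec ha.symm ?_ ?_⟩
  · simp only [classVec]
    split_ifs <;> positivity
  · apply mul_left_cancel₀ hr.ne'
    linear_combination ha - h
  · apply mul_left_cancel₀ hr.ne'
    linear_combination ha - h

/-- For every integer `ν ≥ 5`, the distance spectral radius of
`K_1 ∨ (K_{ν−4} ∪ 3K_1)` is the largest real root of
`x³ − (ν−1)x² − (9ν−29)x − 5ν + 17 = 0`. -/
theorem stmt_17 (ν : ℕ) (hν : 5 ≤ ν) :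
    ∃ r : ℝ, IsGreatest (spectrum ℝ (distMatrix (joinGraph ν))) r ∧
      IsGreatest {x : ℝ |
        x ^ 3 - ((ν : ℝ) - 1) * x ^ 2 - (9 * (ν : ℝ) - 29) * x - 5 * ν + 17 = 0} r := by
  obtain ⟨m, rfl⟩ : ∃ m, ν = m + 4 := ⟨ν - 4, by omega⟩
  have hm : (0 : ℝ) ≤ m := m.cast_nonneg
  have cubic : ∀ x : ℝ, x ^ 3 - (((m + 4 : ℕ) : ℝ) - 1) * x ^ 2 -
      (9 * ((m + 4 : ℕ) : ℝ) - 29) * x - 5 * ((m + 4 : ℕ) : ℝ) + 17 =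
      x ^ 3 - (m + 3) * x ^ 2 - (9 * m + 7) * x - 5 * m - 3 := fun x => by
    push_cast; ring
  simp only [cubic]
  obtain ⟨r, ⟨hr0, -⟩, hr⟩ : (0 : ℝ) ∈
      (fun x : ℝ => x ^ 3 - (m + 3) * x ^ 2 - (9 * m + 7) * x - 5 * m - 3) ''
        Set.Icc 0 (m + 20) := by
    apply intermediate_value_Icc (by positivity) (by fun_prop)
    constructor
    · norm_num; linarith
    · ring_nf; positivity
  have hrpos : 0 < r := hr0.lt_of_ne (by rintro rfl; norm_num at hr; linarith)
  obtain ⟨w, hw, hrw⟩ := exists_pos_eigenvector_of_cubic hrpos hr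
  have ne_zero : ∀ w : Fin (m + 4) → ℝ, (∀ i, 0 < w i) → w ≠ 0 := fun w hw h =>
    (hw 0).ne' (congrFun h 0)
  have bound : ∀ μ ∈ spectrum ℝ (distMatrix (joinGraph (m + 4))), μ ≤ r := fun μ hμ =>
    Matrix.le_of_mem_spectrum_of_pos_eigenvector (fun i j => Nat.cast_nonneg _) hw hrw hμ
  refine ⟨r, ⟨Matrix.mem_spectrum_of_mulVec_eq_smul (ne_zero w hw) hrw, bound⟩, hr, fun s hs => ?_⟩
  rcases le_or_gt s 0 with hs0 | hs0
  · exact hs0.trans hr0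
  · obtain ⟨w', hw', hsw⟩ := exists_pos_eigenvector_of_cubic hs0 hs
    exact bound s (Matrix.mem_spectrum_of_mulVec_eq_smul (ne_zero w' hw') hsw)
end

section
/- For integers X ≥ 1, the distance spectral radius of K_X ∨ (2X+1)K_1 is the largest root of x² − (5X−1)x + 2X² − 5X = 0. -/
/-- The graph `K_X ∨ (2X+1)K_1` on `Fin (3X+1)`: the first `X` vertices form
the clique and the remaining `2X+1` vertices are independent. -/
def joinKXGraph (X : ℕ) : SimpleGraph (Fin (3 * X + 1)) :=
  SimpleGraph.fromRel (fun u _ => u.val < X)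

theorem joinKXGraph_adj {X : ℕ} {u v : Fin (3 * X + 1)} :
    (joinKXGraph X).Adj u v ↔ u ≠ v ∧ (u.val < X ∨ v.val < X) := by
  simp [joinKXGraph, SimpleGraph.fromRel_adj]

theorem distMatrix_joinKXGraph_apply {X : ℕ} (hX : 1 ≤ X) (u v : Fin (3 * X + 1)) :
    distMatrix (joinKXGraph X) u v =
      if u = v then 0 else if u.val < X ∨ v.val < X then 1 else 2 := by
  simp only [distMatrix, Matrix.of_apply]
  split_ifs with huv h
  · simp [huv]
  · exact_mod_cast SimpleGraph.dist_eq_one_iff_adj.2 (joinKXGraph_adj.2 ⟨huv, h⟩)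
  · have hu : (joinKXGraph X).Adj u 0 := joinKXGraph_adj.2
      ⟨fun e => h (Or.inl (by rw [e]; exact hX)), Or.inr hX⟩
    have hv : (joinKXGraph X).Adj 0 v := joinKXGraph_adj.2
      ⟨fun e => h (Or.inr (by rw [← e]; exact hX)), Or.inl hX⟩
    let p : (joinKXGraph X).Walk u v := .cons hu (.cons hv .nil)
    have hle : (joinKXGraph X).dist u v ≤ 2 := SimpleGraph.dist_le p
    have hzero : (joinKXGraph X).dist u v ≠ 0 := fun e => huv (p.reachable.dist_eq_zero_iff.1 e)
    have hone : (joinKXGraph X).dist u v ≠ 1 := fun e =>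
      h (joinKXGraph_adj.1 (SimpleGraph.dist_eq_one_iff_adj.1 e)).2
    have htwo : (joinKXGraph X).dist u v = 2 := by omega
    exact_mod_cast htwo

theorem distMatrix_joinKXGraph_mulVec {X : ℕ} (hX : 1 ≤ X) (f : Fin (3 * X + 1) → ℝ)
    (u : Fin (3 * X + 1)) :
    (distMatrix (joinKXGraph X)).mulVec f u =
      if u.val < X then
        (∑ v with v.val < X, f v) + (∑ v with ¬ v.val < X, f v) - f u
      else
        (∑ v with v.val < X, f v) + 2 * (∑ v with ¬ v.val < X, f v) - 2 * f u := by
  have key : ∀ c : ℝ, (∑ v with v.val < X, f v) + c * (∑ v with ¬ v.val < X, f v) - c * f u =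
      ∑ v, ((if v.val < X then f v else c * f v) - if u = v then c * f v else 0) := by
    intro c
    simp [Finset.sum_sub_distrib, Finset.sum_ite, Finset.mul_sum]
  have key_one := key 1
  rw [one_mul, one_mul] at key_one
  simp only [Matrix.mulVec, dotProduct, distMatrix_joinKXGraph_apply hX]
  split_ifs with hu
  · rw [key_one]
    refine Finset.sum_congr rfl fun v _ => ?_
    by_cases huv : u = v <;> simp [huv, hu]
  · rw [key 2]
    refine Finset.sum_congr rfl fun v _ => ?_
    by_cases huv : u = v
    · subst huv
      simp [hu]
    · by_cases hv : v.val < X <;> simp [huv, hu, hv]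

theorem card_filter_val_lt_joinKX (X : ℕ) :
    (Finset.univ.filter fun v : Fin (3 * X + 1) => v.val < X).card = X := by
  rw [Fin.card_filter_val_lt]
  omega

theorem card_filter_not_val_lt_joinKX (X : ℕ) :
    (Finset.univ.filter fun v : Fin (3 * X + 1) => ¬ v.val < X).card = 2 * X + 1 := by
  have h := Finset.card_filter_add_card_filter_not (s := Finset.univ)
    (fun v : Fin (3 * X + 1) => v.val < X)
  rw [card_filter_val_lt_joinKX, Finset.card_univ, Fintype.card_fin] at h
  omega

theorem Matrix.mem_spectrum_iff_exists_mulVec {n K : Type*} [Fintype n] [DecidableEq n] [Field K]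
    (A : Matrix n n K) (μ : K) :
    μ ∈ spectrum K A ↔ ∃ f : n → K, f ≠ 0 ∧ A.mulVec f = μ • f := by
  rw [← Matrix.spectrum_toLin', ← Module.End.hasEigenvalue_iff_mem_spectrum]
  constructor
  · intro h
    obtain ⟨f, hf⟩ := h.exists_hasEigenvector
    exact ⟨f, hf.2, by simpa using hf.apply_eq_smul⟩
  · rintro ⟨f, hf, h⟩
    exact Module.End.hasEigenvalue_of_hasEigenvector
      (Module.End.hasEigenvector_iff.2 ⟨Module.End.mem_eigenspace_iff.2 (by simpa using h), hf⟩)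

theorem mem_spectrum_of_quotient_root {X : ℕ} (hX : 1 ≤ X) {r : ℝ}
    (hr : r ^ 2 - (5 * (X : ℝ) - 1) * r + 2 * (X : ℝ) ^ 2 - 5 * X = 0) :
    r ∈ spectrum ℝ (distMatrix (joinKXGraph X)) := by
  rw [Matrix.mem_spectrum_iff_exists_mulVec]
  let f : Fin (3 * X + 1) → ℝ := fun v => if v.val < X then 2 * X + 1 else r - (X - 1)
  have hA : ∑ v with v.val < X, f v = X * (2 * X + 1) := by
    rw [Finset.sum_congr rfl fun v hv => if_pos (Finset.mem_filter.1 hv).2]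
    simp only [Finset.sum_const, card_filter_val_lt_joinKX, nsmul_eq_mul]
  have hB : ∑ v with ¬ v.val < X, f v = (2 * X + 1) * (r - (X - 1)) := by
    rw [Finset.sum_congr rfl fun v hv => if_neg (Finset.mem_filter.1 hv).2]
    simp only [Finset.sum_const, card_filter_not_val_lt_joinKX, nsmul_eq_mul]
    push_cast
    ring
  refine ⟨f, fun h => ?_, ?_⟩
  · have h0 : f 0 = 2 * X + 1 := if_pos hX
    rw [h, Pi.zero_apply] at h0
    have : (0 : ℝ) ≤ X := X.cast_nonneg
    linarith
  · ext u
    rw [distMatrix_joinKXGraph_mulVec hX, hA, hB, Pi.smul_apply, smul_eq_mul]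
    split_ifs with hu
    · rw [show f u = 2 * X + 1 from if_pos hu]
      ring
    · rw [show f u = r - (X - 1) from if_neg hu]
      linear_combination -hr

theorem quotient_root_of_mem_spectrum {X : ℕ} (hX : 1 ≤ X) {μ : ℝ} (hμ : -1 < μ)
    (h : μ ∈ spectrum ℝ (distMatrix (joinKXGraph X))) :
    μ ^ 2 - (5 * (X : ℝ) - 1) * μ + 2 * (X : ℝ) ^ 2 - 5 * X = 0 := by
  obtain ⟨f, hf, hDf⟩ := (Matrix.mem_spectrum_iff_exists_mulVec _ _).1 h
  by_contra hp
  set A := ∑ v with v.val < X, f v with hAdef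
  set B := ∑ v with ¬ v.val < X, f v with hBdef
  have hrow : ∀ u, _ = μ * f u := fun u =>
    (distMatrix_joinKXGraph_mulVec hX f u).symm.trans (congrFun hDf u)
  have hclique : ∀ u : Fin (3 * X + 1), u.val < X → A + B = (μ + 1) * f u := by
    intro u hu
    have := hrow u
    rw [if_pos hu] at this
    linear_combination this
  have hindep : ∀ u : Fin (3 * X + 1), ¬ u.val < X → A + 2 * B = (μ + 2) * f u := by
    intro u hu
    have := hrow u
    rw [if_neg hu] at this
    linear_combination this
  have hA : X * (A + B) = (μ + 1) * A := by
    conv_rhs => rw [hAdef, Finset.mul_sum,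
      ← Finset.sum_congr rfl fun v hv => hclique v (Finset.mem_filter.1 hv).2]
    rw [Finset.sum_const, card_filter_val_lt_joinKX, nsmul_eq_mul]
  have hB : (2 * X + 1) * (A + 2 * B) = (μ + 2) * B := by
    conv_rhs => rw [hBdef, Finset.mul_sum,
      ← Finset.sum_congr rfl fun v hv => hindep v (Finset.mem_filter.1 hv).2]
    rw [Finset.sum_const, card_filter_not_val_lt_joinKX, nsmul_eq_mul]
    push_cast
    ring
  have hA0 : A = 0 := (mul_eq_zero.1 (show _ * A = 0 by
    linear_combination (-(μ - 4 * X)) * hA - X * hB)).resolve_left hp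
  have hB0 : B = 0 := (mul_eq_zero.1 (show _ * B = 0 by
    linear_combination (-(2 * X + 1)) * hA - (μ + 1 - X) * hB)).resolve_left hp
  refine hf (funext fun u => ?_)
  by_cases hu : u.val < X
  · have := hclique u hu
    rw [hA0, hB0, add_zero, eq_comm, mul_eq_zero] at this
    exact this.resolve_left (by linarith)
  · have := hindep u hu
    rw [hA0, hB0, mul_zero, add_zero, eq_comm, mul_eq_zero] at this
    exact this.resolve_left (by linarith)

/-- For integers `X ≥ 1`, the distance spectral radius of `K_X ∨ (2X+1)K_1` is
the largest root of `x² − (5X−1)x + 2X² − 5X = 0`. -/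
theorem stmt_18 (X : ℕ) (hX : 1 ≤ X) :
    ∃ r : ℝ, IsGreatest (spectrum ℝ (distMatrix (joinKXGraph X))) r ∧
      IsGreatest {x : ℝ |
        x ^ 2 - (5 * (X : ℝ) - 1) * x + 2 * (X : ℝ) ^ 2 - 5 * X = 0} r := by
  have hX' : (1 : ℝ) ≤ X := by exact_mod_cast hX
  have hs : √(17 * (X : ℝ) ^ 2 + 10 * X + 1) ^ 2 = 17 * (X : ℝ) ^ 2 + 10 * X + 1 :=
    Real.sq_sqrt (by positivity)
  have hs0 := Real.sqrt_nonneg (17 * (X : ℝ) ^ 2 + 10 * X + 1)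
  set s := √(17 * (X : ℝ) ^ 2 + 10 * X + 1)
  have hr : ((5 * X - 1 + s) / 2) ^ 2 - (5 * (X : ℝ) - 1) * ((5 * X - 1 + s) / 2) +
      2 * (X : ℝ) ^ 2 - 5 * X = 0 := by
    linear_combination hs / 4
  have hmax : IsGreatest {x : ℝ |
      x ^ 2 - (5 * (X : ℝ) - 1) * x + 2 * (X : ℝ) ^ 2 - 5 * X = 0} ((5 * X - 1 + s) / 2) := by
    refine ⟨hr, fun x hx => ?_⟩
    change x ^ 2 - (5 * (X : ℝ) - 1) * x + 2 * (X : ℝ) ^ 2 - 5 * X = 0 at hx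
    have hsq : (2 * x - (5 * X - 1)) ^ 2 = s ^ 2 := by
      linear_combination 4 * hx - hs
    linarith [(abs_le_of_sq_le_sq' hsq.le hs0).2]
  refine ⟨_, ⟨mem_spectrum_of_quotient_root hX hr, fun μ hμ => ?_⟩, hmax⟩
  by_contra! hlt
  exact hlt.not_ge (hmax.2 (quotient_root_of_mem_spectrum hX (by linarith) hμ))
end
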